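/- Let M ⊆ ℝ^N be a compact C² d-dimensional submanifold with reach R > 0, and let σ be a non-degenerate simplex contained in the δ-tubular neighborhood of M, enclosed in a ball of radius ρ, with 16δ ≤ ρ ≤ R/3. Then for every x in the convex hull of σ, the angle between Aff(σ) and the (affine) tangent space of M at π_M(x) satisfies ∠(Aff σ, T_{π_M(x)}M) ≤ arcsin( (2·dim(σ)/height(σ)) · (3ρ²/R + δ) ). -/

import Mathlib

open scoped Classical
open Metric Set Module

/-- A point `x` has a unique nearest point in `M`. -/
def HasUniqueNearest {N : ℕ} (M : Set (EuclideanSpace ℝ (Fin N)))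
    (x : EuclideanSpace ℝ (Fin N)) : Prop :=
  ∃! m, m ∈ M ∧ dist x m = Metric.infDist x M

/-- The reach of a set `M ⊆ ℝ^N`. -/
noncomputable def reach {N : ℕ} (M : Set (EuclideanSpace ℝ (Fin N))) : ENNReal :=
  ⨆ (r : NNReal) (_ : ∀ x, Metric.infDist x M < r → HasUniqueNearest M x), (r : ENNReal)

/-- A nearest point of `M` to `x` (the nearest-point projection `π_M`). -/
noncomputable def nearestPt {N : ℕ} (M : Set (EuclideanSpace ℝ (Fin N)))
    (x : EuclideanSpace ℝ (Fin N)) : EuclideanSpace ℝ (Fin N) :=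
  if h : ∃ m ∈ M, dist x m = Metric.infDist x M then h.choose else x

/-- `M` is a `d`-dimensional `C²` submanifold of `ℝ^N`. -/
def IsC2Submanifold {N : ℕ} (d : ℕ) (M : Set (EuclideanSpace ℝ (Fin N))) : Prop :=
  ∀ x ∈ M, ∃ (U : Set (EuclideanSpace ℝ (Fin d)))
      (ξ : EuclideanSpace ℝ (Fin d) → EuclideanSpace ℝ (Fin N))
      (V : Set (EuclideanSpace ℝ (Fin N))),
    IsOpen U ∧ IsOpen V ∧ x ∈ V ∧ ContDiffOn ℝ 2 ξ U ∧ Set.InjOn ξ U ∧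
    ξ '' U = M ∩ V ∧
    (∀ u ∈ U, Function.Injective (fderivWithin ℝ ξ U u)) ∧
    ContinuousOn (Function.invFunOn ξ U) (M ∩ V)

/-- The tangent space of `M` at `m`, as the span of the tangent cone. -/
noncomputable def tangentSpan {N : ℕ} (M : Set (EuclideanSpace ℝ (Fin N)))
    (m : EuclideanSpace ℝ (Fin N)) : Submodule ℝ (EuclideanSpace ℝ (Fin N)) :=
  Submodule.span ℝ (tangentConeAt ℝ M m)

/-- The angle between two subspaces of an inner product space. -/
noncomputable def subspaceAngle {E : Type*} [NormedAddCommGroup E] [InnerProductSpace ℝ E]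
    (V₀ V₁ : Submodule ℝ E) : ℝ :=
  sSup {θ : ℝ | ∃ v₀ ∈ V₀, v₀ ≠ 0 ∧
    θ = sInf {φ : ℝ | ∃ v₁ ∈ V₁, v₁ ≠ 0 ∧ φ = InnerProductGeometry.angle v₀ v₁}}

/-- The height (minimal altitude) of a simplex with vertex set `σ`. -/
noncomputable def simplexHeight {N : ℕ} (σ : Finset (EuclideanSpace ℝ (Fin N)))
    (h : σ.Nonempty) : ℝ :=
  σ.inf' h fun v =>
    Metric.infDist v (affineSpan ℝ ((σ.erase v : Finset (EuclideanSpace ℝ (Fin N))) : Set (EuclideanSpace ℝ (Fin N))))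

theorem le_of_sq_le_sq_aux {a b : ℝ} (h : a ^ 2 ≤ b ^ 2) (hb : 0 ≤ b) : a ≤ b :=
  (le_abs_self a).trans (abs_le_of_sq_le_sq h hb)

open Filter Topology in
/-- Extension of the empty ball property: if `m` is nearest to `m + h n`, then the open ball of
radius `R` tangent at `m` in the direction `n` contains no point of `M`. -/
theorem ext_aux {N : ℕ} {M : Set (EuclideanSpace ℝ (Fin N))} (hMc : IsCompact M)
    (hMne : M.Nonempty) {R : ℝ}
    (huniq : ∀ x, Metric.infDist x M < R → HasUniqueNearest M x)
    {m z : EuclideanSpace ℝ (Fin N)} (hm : m ∈ M) (hz : Metric.infDist z M = ‖z - m‖)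
    (hpos : 0 < ‖z - m‖) {t : ℝ} (ht : 0 < t) (htR : ‖z - m‖ + t < R) :
    ∃ y, ‖y - z‖ ≤ t ∧ ‖z - m‖ + t ≤ Metric.infDist y M := by
  set f : EuclideanSpace ℝ (Fin N) → ℝ := fun y => Metric.infDist y M with hf
  have hfc : Continuous f := Metric.continuous_infDist_pt M
  have hK : IsCompact (Metric.closedBall z t) := isCompact_closedBall z t
  have hKne : (Metric.closedBall z t).Nonempty := ⟨z, Metric.mem_closedBall_self ht.le⟩
  have key : ∀ l : ℝ, 0 < l → l < 1 → ∃ y ∈ Metric.closedBall z t, ‖z - m‖ + l * t ≤ f y := by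
    intro l hl0 hl1
    obtain ⟨y, hyK, hymax⟩ := hK.exists_isMaxOn hKne (f := fun y => f y - l * ‖y - z‖)
      (by fun_prop)
    have hmax : ∀ w, ‖w - z‖ ≤ t → f w - l * ‖w - z‖ ≤ f y - l * ‖y - z‖ := by
      intro w hw
      exact hymax (by simpa [dist_eq_norm] using hw)
    have hyt : ‖y - z‖ ≤ t := by simpa [dist_eq_norm] using hyK
    have hfz : f z = ‖z - m‖ := hz
    have h0 := hmax z (by simpa using ht.le)
    simp only [sub_self, norm_zero, mul_zero, sub_zero] at h0
    rcases hyt.eq_or_lt with heq | hlt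
    · refine ⟨y, hyK, ?_⟩
      rw [heq] at h0; linarith
    exfalso
    have hfy : 0 < f y := by
      have : 0 ≤ l * ‖y - z‖ := by positivity
      linarith
    have hfyR : f y < R := by
      have h1 : f y ≤ dist y m := Metric.infDist_le_dist_of_mem hm
      have h2 := dist_triangle y z m
      rw [dist_eq_norm y z, dist_eq_norm z m] at h2
      linarith
    obtain ⟨p, ⟨hpM, hp⟩, hpu⟩ := huniq y hfyR
    have hp' : ‖y - p‖ = f y := by rw [← dist_eq_norm]; exact hp
    set u : EuclideanSpace ℝ (Fin N) := (f y)⁻¹ • (y - p) with hu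
    have hun : ‖u‖ = 1 := by
      rw [hu, norm_smul, hp', norm_inv, Real.norm_of_nonneg hfy.le, inv_mul_cancel₀ hfy.ne']
    let e : ℕ → ℝ := fun k => (t - ‖y - z‖) * (1 / ((k : ℝ) + 1))
    have he0 : ∀ k, 0 < e k := fun k => mul_pos (by linarith) (by positivity)
    have he1 : ∀ k, e k ≤ t - ‖y - z‖ := by
      intro k
      have : 1 / ((k : ℝ) + 1) ≤ 1 := by
        rw [div_le_one (by positivity)]; linarith [Nat.cast_nonneg (α := ℝ) k]
      have h2 : 0 ≤ t - ‖y - z‖ := by linarith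
      calc e k ≤ (t - ‖y - z‖) * 1 := mul_le_mul_of_nonneg_left this h2
        _ = _ := mul_one _
    have helim : Tendsto e atTop (𝓝 0) := by
      have := (tendsto_one_div_add_atTop_nhds_zero_nat (𝕜 := ℝ)).const_mul (t - ‖y - z‖)
      simpa [e] using this
    have hex : ∀ k, ∃ q ∈ M, Metric.infDist (y + e k • u) M = dist (y + e k • u) q :=
      fun k => hMc.exists_infDist_eq_dist hMne _
    choose q hqM hq using hex
    obtain ⟨a, haM, φ, hφ, hlim⟩ := hMc.tendsto_subseq hqM
    have helim' : Tendsto (fun k => e (φ k)) atTop (𝓝 0) := helim.comp hφ.tendsto_atTop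
    have hylim : Tendsto (fun k => y + e (φ k) • u) atTop (𝓝 y) := by
      have := (helim'.smul_const u).const_add y
      simpa using this
    have hay : a = p := by
      apply hpu
      refine ⟨haM, ?_⟩
      have h1 : Tendsto (fun k => f (y + e (φ k) • u)) atTop (𝓝 (f y)) :=
        (hfc.tendsto y).comp hylim
      have h2 : Tendsto (fun k => dist (y + e (φ k) • u) (q (φ k))) atTop (𝓝 (dist y a)) :=
        hylim.dist hlim
      have h3 : (fun k => f (y + e (φ k) • u)) = fun k => dist (y + e (φ k) • u) (q (φ k)) := by
        funext k; exact hq _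
      rw [h3] at h1
      exact tendsto_nhds_unique h2 h1
    have hineq : ∀ k, 2 * inner ℝ u (y - q k) + e k ≤ 2 * l * f y + l ^ 2 * e k := by
      intro k
      have hnk : ‖y + e k • u - z‖ ≤ ‖y - z‖ + e k := by
        have : y + e k • u - z = (y - z) + e k • u := by abel
        rw [this]
        refine (norm_add_le _ _).trans ?_
        rw [norm_smul, hun, Real.norm_of_nonneg (he0 k).le, mul_one]
      have h1 := hmax (y + e k • u) (by linarith [he1 k])
      have h2 : f (y + e k • u) ≤ f y + l * e k := by nlinarith
      have h3 : f (y + e k • u) = ‖(y - q k) + e k • u‖ := by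
        rw [hf]; simp only; rw [hq k, dist_eq_norm]; congr 1; abel
      have h4 : ‖(y - q k) + e k • u‖ ^ 2
          = ‖y - q k‖ ^ 2 + 2 * (e k * inner ℝ u (y - q k)) + (e k) ^ 2 := by
        rw [norm_add_sq_real, inner_smul_right, norm_smul, hun, Real.norm_of_nonneg (he0 k).le,
          mul_one, real_inner_comm]
      have h5 : f y ≤ ‖y - q k‖ := by
        rw [← dist_eq_norm]; exact Metric.infDist_le_dist_of_mem (hqM k)
      have h6 : ‖(y - q k) + e k • u‖ ^ 2 ≤ (f y + l * e k) ^ 2 := by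
        rw [← h3]
        exact pow_le_pow_left₀ Metric.infDist_nonneg h2 2
      have h7 : (f y) ^ 2 ≤ ‖y - q k‖ ^ 2 := pow_le_pow_left₀ hfy.le h5 2
      have h8 : e k * (2 * inner ℝ u (y - q k) + e k) ≤ e k * (2 * l * f y + l ^ 2 * e k) := by
        nlinarith
      exact le_of_mul_le_mul_left h8 (he0 k)
    have hL : Tendsto (fun k => 2 * inner ℝ u (y - q (φ k)) + e (φ k)) atTop
        (𝓝 (2 * inner ℝ u (y - a) + 0)) := by
      refine Tendsto.add (Tendsto.const_mul _ ?_) helim'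
      exact tendsto_const_nhds.inner (tendsto_const_nhds.sub hlim)
    have hRr : Tendsto (fun k => 2 * l * f y + l ^ 2 * e (φ k)) atTop
        (𝓝 (2 * l * f y + l ^ 2 * 0)) := (helim'.const_mul _).const_add _
    have hfin := le_of_tendsto_of_tendsto' hL hRr (fun k => hineq (φ k))
    have hin : inner ℝ u (y - a) = f y := by
      rw [hay, hu, inner_smul_left, real_inner_self_eq_norm_sq, hp']
      simp only [conj_trivial]
      field_simp
    rw [hin] at hfin
    nlinarith
  obtain ⟨y, hyK, hymax⟩ := hK.exists_isMaxOn hKne hfc.continuousOn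
  refine ⟨y, by simpa [dist_eq_norm] using hyK, ?_⟩
  change ‖z - m‖ + t ≤ f y
  by_contra hcon
  push Not at hcon
  have hfz : ‖z - m‖ ≤ f y := by
    have : f z ≤ f y := hymax (Metric.mem_closedBall_self ht.le)
    rwa [show f z = ‖z - m‖ from hz] at this
  -- choose l
  set l : ℝ := ((f y - ‖z - m‖) / t + 1) / 2 with hl
  have hq1 : (f y - ‖z - m‖) / t < 1 := by rw [div_lt_one ht]; linarith
  have hq0 : 0 ≤ (f y - ‖z - m‖) / t := div_nonneg (by linarith) ht.le
  obtain ⟨w, hwK, hw⟩ := key l (by linarith) (by linarith)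
  have h1 : f w ≤ f y := hymax hwK
  have h2 : (f y - ‖z - m‖) / t < l := by linarith
  rw [div_lt_iff₀ ht] at h2
  linarith

theorem ball_aux {N : ℕ} {M : Set (EuclideanSpace ℝ (Fin N))} (hMc : IsCompact M)
    (hMne : M.Nonempty) {R : ℝ}
    (huniq : ∀ x, Metric.infDist x M < R → HasUniqueNearest M x)
    {m z q : EuclideanSpace ℝ (Fin N)} (hm : m ∈ M) (hz : Metric.infDist z M = ‖z - m‖)
    (hzR : ‖z - m‖ < R) (hq : q ∈ M) :
    2 * R * inner ℝ (q - m) (z - m) ≤ ‖z - m‖ * ‖q - m‖ ^ 2 := by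
  rcases (norm_nonneg (z - m)).eq_or_lt with h0 | hpos
  · have : z - m = 0 := norm_eq_zero.mp h0.symm
    simp [this]
  set h := ‖z - m‖ with hh
  have main : ∀ s, h < s → s < R → 2 * s * inner ℝ (q - m) (z - m) ≤ h * ‖q - m‖ ^ 2 := by
    intro s hs1 hs2
    obtain ⟨y, hy1, hy2⟩ := ext_aux hMc hMne huniq hm hz hpos (t := s - h) (by linarith)
      (by linarith)
    have hym : s ≤ ‖y - m‖ := by
      have := Metric.infDist_le_dist_of_mem (x := y) hm
      rw [dist_eq_norm] at this
      linarith
    have hyq : s ≤ ‖y - q‖ := by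
      have := Metric.infDist_le_dist_of_mem (x := y) hq
      rw [dist_eq_norm] at this
      linarith
    -- y = m + (s / h) (z - m)
    have hy3 : ‖(y - z) + (z - m)‖ ^ 2 = ‖y - z‖ ^ 2 + 2 * inner ℝ (y - z) (z - m) + h ^ 2 := by
      rw [norm_add_sq_real]
    rw [sub_add_sub_cancel] at hy3
    have hcs := real_inner_le_norm (y - z) (z - m)
    rw [← hh] at hcs
    have e1 : ‖y - z‖ = s - h := by
      have h1 : ‖y - m‖ ≤ ‖y - z‖ + h := by
        have := norm_add_le (y - z) (z - m)
        rwa [sub_add_sub_cancel] at this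
      linarith
    have e2 : inner ℝ (y - z) (z - m) = (s - h) * h := by
      have : s ^ 2 ≤ ‖y - m‖ ^ 2 := pow_le_pow_left₀ (by linarith) hym 2
      rw [e1] at hcs hy3
      nlinarith
    have e3 : (y - z) - ((s - h) / h) • (z - m) = 0 := by
      have : ‖(y - z) - ((s - h) / h) • (z - m)‖ ^ 2 = 0 := by
        rw [norm_sub_sq_real, inner_smul_right, e1, e2, norm_smul, ← hh,
          Real.norm_of_nonneg (div_nonneg (by linarith) hpos.le)]
        field_simp
        ring
      exact norm_eq_zero.mp (pow_eq_zero_iff (two_ne_zero) |>.mp this)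
    have e4 : y - q = (s / h) • (z - m) - (q - m) := by
      have h1 : y = z + ((s - h) / h) • (z - m) := by
        rw [sub_eq_zero] at e3; rw [← e3]; abel
      have h2 : (s / h) • (z - m) = ((s - h) / h) • (z - m) + (z - m) := by
        have : s / h = (s - h) / h + 1 := by field_simp; ring
        rw [this, add_smul, one_smul]
      rw [h1, h2]; abel
    have e5 : s ^ 2 ≤ ‖y - q‖ ^ 2 := pow_le_pow_left₀ (by linarith) hyq 2
    have hs0 : 0 < s := by linarith
    rw [e4, norm_sub_sq_real, inner_smul_left, norm_smul, ← hh,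
      Real.norm_of_nonneg (div_nonneg hs0.le hpos.le), div_mul_cancel₀ _ hpos.ne',
      conj_trivial, real_inner_comm] at e5
    have e6 : 2 * (s / h * inner ℝ (q - m) (z - m)) ≤ ‖q - m‖ ^ 2 := by linarith
    calc 2 * s * inner ℝ (q - m) (z - m) = h * (2 * (s / h * inner ℝ (q - m) (z - m))) := by
          field_simp
      _ ≤ _ := mul_le_mul_of_nonneg_left e6 hpos.le
  by_contra hcon
  push Not at hcon
  have hc : 0 < inner ℝ (q - m) (z - m) := by
    by_contra h2
    push Not at h2
    have : 0 ≤ h * ‖q - m‖ ^ 2 := by positivity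
    nlinarith
  set i := inner ℝ (q - m) (z - m)
  set B := h * ‖q - m‖ ^ 2
  have h3 : B / (2 * i) < R := by rw [div_lt_iff₀ (by positivity)]; linarith
  obtain ⟨s, hs1, hs2⟩ := exists_between (max_lt hzR h3)
  have h4 := main s ((le_max_left _ _).trans_lt hs1) hs2
  have h5 : B / (2 * i) < s := (le_max_right _ _).trans_lt hs1
  rw [div_lt_iff₀ (by positivity)] at h5
  linarith

open Filter Topology in
theorem normal_aux {N d : ℕ} {M : Set (EuclideanSpace ℝ (Fin N))} (hM : IsC2Submanifold d M)
    {m n : EuclideanSpace ℝ (Fin N)} (hm : m ∈ M) (hn : n ∈ (tangentSpan M m)ᗮ) :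
    ∃ C > 0, ∀ q ∈ M, inner ℝ (q - m) n ≤ C * ‖q - m‖ ^ 2 := by
  obtain ⟨U, ξ, V, hU, hV, hmV, hξ, hinj, himg, hder, hinv⟩ := hM m hm
  set g := Function.invFunOn ξ U with hg
  have hgU : ∀ q ∈ M ∩ V, g q ∈ U ∧ ξ (g q) = q := by
    intro q hq
    rw [← himg] at hq
    exact ⟨Function.invFunOn_mem hq, Function.invFunOn_eq hq⟩
  set u₀ := g m with hu0
  obtain ⟨hu0U, hξu0⟩ := hgU m ⟨hm, hmV⟩
  have hUn : U ∈ 𝓝 u₀ := hU.mem_nhds hu0U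
  have hca : ContDiffAt ℝ 2 ξ u₀ := hξ.contDiffAt hUn
  set D := fderiv ℝ ξ u₀ with hD
  have hDinj : Function.Injective D := by
    have := hder u₀ hu0U
    rwa [fderivWithin_of_isOpen hU hu0U] at this
  have hDorth : ∀ v, inner ℝ (D v) n = 0 := by
    intro v
    refine Submodule.inner_right_of_mem_orthogonal (K := tangentSpan M m) ?_ hn
    refine Submodule.subset_span ?_
    have h1 : HasFDerivWithinAt ξ D U u₀ :=
      (hca.differentiableAt (by norm_num)).hasFDerivAt.hasFDerivWithinAt
    have h2 := h1.mapsTo_tangent_cone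
    rw [tangentConeAt_of_mem_nhds hUn, himg, hξu0] at h2
    exact tangentConeAt_mono inter_subset_left (h2 (mem_univ v))
  obtain ⟨L, s, hs, hL⟩ := (hca.fderiv_right (m := 1) (by norm_num)).exists_lipschitzOnWith
  obtain ⟨r, hr0, hr⟩ := Metric.mem_nhds_iff.mp (inter_mem hUn hs)
  have taylor : ∀ u, ‖u - u₀‖ < r → ‖ξ u - ξ u₀ - D (u - u₀)‖ ≤ L * ‖u - u₀‖ * ‖u - u₀‖ := by
    intro u hu
    have hsub : ∀ w ∈ Metric.closedBall u₀ ‖u - u₀‖, w ∈ U ∩ s := by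
      intro w hw
      apply hr
      rw [Metric.mem_closedBall] at hw
      exact Metric.mem_ball.mpr (hw.trans_lt hu)
    refine Convex.norm_image_sub_le_of_norm_hasFDerivWithin_le' (𝕜 := ℝ) (f' := fderiv ℝ ξ)
      (s := Metric.closedBall u₀ ‖u - u₀‖) ?_ ?_ (convex_closedBall _ _) ?_ ?_
    · intro w hw
      exact ((hξ.contDiffAt (hU.mem_nhds (hsub w hw).1)).differentiableAt
        (by norm_num)).hasFDerivAt.hasFDerivWithinAt
    · intro w hw
      have h1 := hL.norm_sub_le (hsub w hw).2 (mem_of_mem_nhds hs)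
      refine h1.trans (mul_le_mul_of_nonneg_left ?_ L.2)
      simpa [dist_eq_norm] using hw
    · simp
    · simp [dist_eq_norm]
  obtain ⟨K, hK0, hK⟩ := LinearMap.exists_antilipschitzWith (D : EuclideanSpace ℝ (Fin d) →ₗ[ℝ] EuclideanSpace ℝ (Fin N))
    (LinearMap.ker_eq_bot.mpr hDinj)
  have hK' : ∀ v, ‖v‖ ≤ K * ‖D v‖ := by
    intro v
    have := hK.le_mul_dist v 0
    simpa [dist_eq_norm] using this
  have hKp : (0 : ℝ) < K := hK0
  have hLp : (0 : ℝ) ≤ L := L.2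
  -- small radius
  set r' : ℝ := min r (1 / (2 * K * (L + 1))) with hr'
  have hr'0 : 0 < r' := lt_min hr0 (by positivity)
  have low : ∀ u, ‖u - u₀‖ < r' → ‖u - u₀‖ ≤ 2 * K * ‖ξ u - ξ u₀‖ := by
    intro u hu
    have h1 := taylor u (hu.trans_le (min_le_left _ _))
    have h2 : ‖u - u₀‖ < 1 / (2 * K * (L + 1)) := hu.trans_le (min_le_right _ _)
    rw [lt_div_iff₀ (by positivity)] at h2
    have h3 := hK' (u - u₀)
    have h4 : ‖D (u - u₀)‖ ≤ ‖ξ u - ξ u₀‖ + L * ‖u - u₀‖ * ‖u - u₀‖ := by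
      have : D (u - u₀) = (ξ u - ξ u₀) - (ξ u - ξ u₀ - D (u - u₀)) := by abel
      rw [this]
      refine (norm_sub_le _ _).trans ?_
      linarith
    have h5 : 0 ≤ ‖u - u₀‖ := norm_nonneg _
    have h6 : K * ‖D (u - u₀)‖ ≤ K * (‖ξ u - ξ u₀‖ + L * ‖u - u₀‖ * ‖u - u₀‖) :=
      mul_le_mul_of_nonneg_left h4 hKp.le
    have h7 : 2 * (K * L * ‖u - u₀‖) ≤ 1 := by nlinarith [mul_nonneg hKp.le h5]
    have h8 : 2 * (K * L * ‖u - u₀‖) * ‖u - u₀‖ ≤ 1 * ‖u - u₀‖ :=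
      mul_le_mul_of_nonneg_right h7 h5
    nlinarith
  have hcont : ContinuousWithinAt g (M ∩ V) m := hinv m ⟨hm, hmV⟩
  obtain ⟨η, hη0, hη⟩ := Metric.continuousWithinAt_iff.mp hcont r' hr'0
  obtain ⟨ν, hν0, hν⟩ := Metric.isOpen_iff.mp hV m hmV
  set κ := min η ν with hκ
  have hκ0 : 0 < κ := lt_min hη0 hν0
  refine ⟨‖n‖ * (L * (2 * K) ^ 2) + ‖n‖ / κ + 1, by positivity, ?_⟩
  intro q hqM
  have hnn := norm_nonneg n
  rcases lt_or_ge (dist q m) κ with hlt | hge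
  · have hqV : q ∈ V := hν (hlt.trans_le (min_le_right _ _))
    obtain ⟨huU, hξu⟩ := hgU q ⟨hqM, hqV⟩
    have hu : ‖g q - u₀‖ < r' := by
      rw [← dist_eq_norm]; exact hη ⟨hqM, hqV⟩ (hlt.trans_le (min_le_left _ _))
    have h1 := taylor _ (hu.trans_le (min_le_left _ _))
    have h2 := low _ hu
    rw [hξu, hξu0] at h1 h2
    have h3 : inner ℝ (q - m) n = inner ℝ (q - m - D (g q - u₀)) n := by
      rw [inner_sub_left (q - m), hDorth, sub_zero]
    have h4 := real_inner_le_norm (q - m - D (g q - u₀)) n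
    have h5 : L * ‖g q - u₀‖ * ‖g q - u₀‖ ≤ L * (2 * K) ^ 2 * ‖q - m‖ ^ 2 := by
      have : ‖g q - u₀‖ ^ 2 ≤ (2 * K * ‖q - m‖) ^ 2 := pow_le_pow_left₀ (norm_nonneg _) h2 2
      have := mul_le_mul_of_nonneg_left this hLp
      nlinarith
    have h6 : ‖q - m - D (g q - u₀)‖ * ‖n‖ ≤ L * (2 * K) ^ 2 * ‖q - m‖ ^ 2 * ‖n‖ :=
      mul_le_mul_of_nonneg_right (h1.trans h5) hnn
    have h7 : 0 ≤ (‖n‖ / κ + 1) * ‖q - m‖ ^ 2 := by positivity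
    rw [h3]
    nlinarith
  · rw [dist_eq_norm] at hge
    have h4 := real_inner_le_norm (q - m) n
    have h5 : ‖q - m‖ * ‖n‖ ≤ ‖n‖ / κ * ‖q - m‖ ^ 2 := by
      rw [div_mul_eq_mul_div, le_div_iff₀ hκ0]
      have := mul_le_mul_of_nonneg_left hge (mul_nonneg (norm_nonneg (q - m)) hnn)
      nlinarith
    have h7 : 0 ≤ (‖n‖ * (L * (2 * K) ^ 2) + 1) * ‖q - m‖ ^ 2 := by positivity
    nlinarith

/-- Federer bound on the distance to the tangent space. -/
theorem federer_aux {N d : ℕ} {M : Set (EuclideanSpace ℝ (Fin N))} (hM : IsC2Submanifold d M)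
    (hMc : IsCompact M) (hMne : M.Nonempty) {R : ℝ} (hR : 0 < R)
    (huniq : ∀ x, Metric.infDist x M < R → HasUniqueNearest M x)
    {m q : EuclideanSpace ℝ (Fin N)} (hm : m ∈ M) (hq : q ∈ M) :
    ‖(tangentSpan M m)ᗮ.starProjection (q - m)‖ ≤ ‖q - m‖ ^ 2 / (2 * R) := by
  set w := (tangentSpan M m)ᗮ.starProjection (q - m) with hw
  have hwm : w ∈ (tangentSpan M m)ᗮ := Submodule.starProjection_apply_mem _ _
  have hin : inner ℝ (q - m) w = ‖w‖ ^ 2 := by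
    have h := Submodule.starProjection_inner_eq_zero (K := (tangentSpan M m)ᗮ) (q - m) w hwm
    rw [inner_sub_left, ← hw, real_inner_self_eq_norm_sq] at h
    linarith
  rcases (norm_nonneg w).eq_or_lt with h0 | hpos
  · rw [← h0]; positivity
  obtain ⟨C, hC, hCb⟩ := normal_aux hM hm hwm
  obtain ⟨ε, hε0, hε⟩ := exists_between (show (0 : ℝ) < min (R / ‖w‖) (1 / (2 * C)) from
    lt_min (by positivity) (by positivity))
  have hε1 : ε * ‖w‖ < R := by
    have := hε.trans_le (min_le_left _ _)
    rwa [lt_div_iff₀ hpos] at this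
  have hε2 : ε * (2 * C) < 1 := by
    have := hε.trans_le (min_le_right _ _)
    rwa [lt_div_iff₀ (by positivity)] at this
  set z := m + ε • w with hz
  have hzm : z - m = ε • w := by rw [hz]; abel
  have hznorm : ‖z - m‖ = ε * ‖w‖ := by rw [hzm, norm_smul, Real.norm_of_nonneg hε0.le]
  have hzd : Metric.infDist z M = ‖z - m‖ := by
    apply le_antisymm
    · rw [← dist_eq_norm]; exact Metric.infDist_le_dist_of_mem hm
    · rw [Metric.le_infDist hMne]
      intro y hy
      rw [dist_eq_norm]
      have h1 : z - y = ε • w - (y - m) := by rw [hz]; abel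
      have h2 := hCb y hy
      have h3 : ‖z - y‖ ^ 2 = ‖z - m‖ ^ 2 - 2 * (ε * inner ℝ (y - m) w) + ‖y - m‖ ^ 2 := by
        rw [h1, norm_sub_sq_real, inner_smul_left, hzm, conj_trivial, real_inner_comm]
      have h4 : ε * inner ℝ (y - m) w ≤ ε * (C * ‖y - m‖ ^ 2) :=
        mul_le_mul_of_nonneg_left h2 hε0.le
      have h5 : ‖z - m‖ ^ 2 ≤ ‖z - y‖ ^ 2 := by nlinarith [sq_nonneg ‖y - m‖]
      exact le_of_sq_le_sq_aux h5 (norm_nonneg _)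
  have hb := ball_aux hMc hMne huniq hm hzd (by rw [hznorm]; exact hε1) hq
  rw [hznorm, hzm, inner_smul_right, hin] at hb
  rw [le_div_iff₀ (by positivity)]
  have h6 : ε * ‖w‖ * (‖w‖ * (2 * R)) ≤ ε * ‖w‖ * ‖q - m‖ ^ 2 := by nlinarith
  exact le_of_mul_le_mul_left h6 (by positivity)

theorem coeff_aux {E : Type*} [NormedAddCommGroup E] [InnerProductSpace ℝ E] (σ : Finset E)
    {w : E} (hw : w ∈ vectorSpan ℝ (σ : Set E)) :
    ∃ a : E → ℝ, ∑ v ∈ σ, a v = 0 ∧ ∑ v ∈ σ, a v • v = w := by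
  rw [vectorSpan] at hw
  induction hw using Submodule.span_induction with
  | mem x hx =>
    obtain ⟨u, hu, v, hv, rfl⟩ := Set.mem_vsub.mp hx
    refine ⟨fun y => (if y = u then 1 else 0) - (if y = v then 1 else 0), ?_, ?_⟩
    · simp [Finset.sum_sub_distrib, Finset.mem_coe.mp hu, Finset.mem_coe.mp hv]
    · simp [sub_smul, Finset.sum_sub_distrib, Finset.mem_coe.mp hu, Finset.mem_coe.mp hv]
  | zero => exact ⟨0, by simp, by simp⟩
  | add x y _ _ hx hy =>
    obtain ⟨a, ha, ha'⟩ := hx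
    obtain ⟨b, hb, hb'⟩ := hy
    exact ⟨a + b, by simp [Finset.sum_add_distrib, ha, hb],
      by simp [add_smul, Finset.sum_add_distrib, ha', hb']⟩
  | smul c x _ hx =>
    obtain ⟨a, ha, ha'⟩ := hx
    exact ⟨c • a, by simp [← Finset.mul_sum, ha], by simp [mul_smul, ← Finset.smul_sum, ha']⟩

theorem altitude_aux {E : Type*} [DecidableEq E] [NormedAddCommGroup E] [InnerProductSpace ℝ E] (σ : Finset E)
    {w : E} {a : E → ℝ} (ha : ∑ v ∈ σ, a v = 0) (haw : ∑ v ∈ σ, a v • v = w) {v : E} (hv : v ∈ σ) :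
    |a v| * Metric.infDist v (affineSpan ℝ ((σ.erase v : Finset E) : Set E)) ≤ ‖w‖ := by
  by_cases h0 : a v = 0
  · simp [h0]
  rw [← Finset.add_sum_erase _ _ hv] at ha haw
  have hmem : v - (a v)⁻¹ • w ∈ affineSpan ℝ ((σ.erase v : Finset E) : Set E) := by
    have hs : ∑ u ∈ σ.erase v, (-(a v)⁻¹ * a u) = 1 := by
      rw [← Finset.mul_sum, show ∑ u ∈ σ.erase v, a u = - a v by linarith]
      field_simp
    have := affineCombination_mem_affineSpan_image hs (s' := ((σ.erase v : Finset E) : Set E))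
      (fun i hi hi' => absurd (Finset.mem_coe.mpr hi) hi') (id : E → E)
    rw [Finset.affineCombination_eq_linear_combination _ _ _ hs, Set.image_id] at this
    convert this using 1
    simp only [id, mul_smul, ← Finset.smul_sum]
    rw [← haw, smul_add, smul_smul, inv_mul_cancel₀ h0]
    simp
  have h1 := Metric.infDist_le_dist_of_mem (x := v) hmem
  rw [dist_eq_norm, sub_sub_cancel, norm_smul, norm_inv, Real.norm_eq_abs] at h1
  have h2 := mul_le_mul_of_nonneg_left h1 (abs_nonneg (a v))
  rwa [mul_inv_cancel_left₀ (abs_ne_zero.mpr h0)] at h2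

theorem angle_aux {E : Type*} [NormedAddCommGroup E] [InnerProductSpace ℝ E]
    [FiniteDimensional ℝ E] (T : Submodule ℝ E) {w : E} (hw : w ≠ 0) {s : ℝ} (hs0 : 0 ≤ s)
    (hs : ‖Tᗮ.starProjection w‖ ≤ s * ‖w‖) :
    sInf {φ : ℝ | ∃ v₁ ∈ T, v₁ ≠ 0 ∧ φ = InnerProductGeometry.angle w v₁} ≤ Real.arcsin s := by
  have hbdd : BddBelow {φ : ℝ | ∃ v₁ ∈ T, v₁ ≠ 0 ∧ φ = InnerProductGeometry.angle w v₁} := by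
    refine ⟨0, ?_⟩
    rintro _ ⟨v, _, _, rfl⟩
    exact InnerProductGeometry.angle_nonneg _ _
  have hwpos : 0 < ‖w‖ := norm_pos_iff.mpr hw
  have hsum : T.starProjection w + Tᗮ.starProjection w = w :=
    Submodule.starProjection_add_starProjection_orthogonal _
  by_cases hp : T.starProjection w = 0
  · by_cases hT : T = ⊥
    · have : {φ : ℝ | ∃ v₁ ∈ T, v₁ ≠ 0 ∧ φ = InnerProductGeometry.angle w v₁} = ∅ := by
        ext φ
        simp only [hT, Submodule.mem_bot, mem_ofPred_eq, mem_empty_iff_false, iff_false]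
        rintro ⟨v, hv, hv', _⟩
        exact hv' hv
      rw [this, Real.sInf_empty]
      exact Real.arcsin_nonneg.mpr hs0
    · obtain ⟨v, hvT, hv0⟩ := T.ne_bot_iff.mp hT
      refine (csInf_le hbdd ⟨v, hvT, hv0, rfl⟩).trans ?_
      rw [hp, zero_add] at hsum
      rw [hsum] at hs
      have h1 : 1 ≤ s := by
        by_contra h
        push Not at h
        nlinarith
      rw [Real.arcsin_of_one_le h1]
      have hwT : w ∈ Tᗮ := by rw [← hsum]; exact Submodule.starProjection_apply_mem _ _
      have : inner ℝ w v = 0 := Submodule.inner_left_of_mem_orthogonal hvT hwT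
      rw [InnerProductGeometry.inner_eq_zero_iff_angle_eq_pi_div_two] at this
      exact this.le
  · refine (csInf_le hbdd ⟨_, Submodule.starProjection_apply_mem _ _, hp, rfl⟩).trans ?_
    have hin : inner ℝ (T.starProjection w) (Tᗮ.starProjection w) = 0 :=
      Submodule.inner_right_of_mem_orthogonal (Submodule.starProjection_apply_mem _ _)
        (Submodule.starProjection_apply_mem _ _)
    have := InnerProductGeometry.angle_add_eq_arcsin_of_inner_eq_zero hin (Or.inl hp)
    rw [hsum] at this
    rw [InnerProductGeometry.angle_comm, this]
    apply Real.arcsin_le_arcsin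
    rwa [div_le_iff₀ hwpos]

theorem uniq_aux {N : ℕ} {M : Set (EuclideanSpace ℝ (Fin N))} {R : ℝ}
    (hreach : ENNReal.ofReal R = reach M) (x : EuclideanSpace ℝ (Fin N))
    (hx : Metric.infDist x M < R) : HasUniqueNearest M x := by
  have hR : 0 < R := Metric.infDist_nonneg.trans_lt hx
  have h1 : ENNReal.ofReal (Metric.infDist x M) < reach M := by
    rw [← hreach]; exact (ENNReal.ofReal_lt_ofReal_iff hR).mpr hx
  unfold reach at h1
  obtain ⟨r, hr⟩ := lt_iSup_iff.mp h1
  obtain ⟨hr', hr⟩ := lt_iSup_iff.mp hr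
  apply hr'
  rw [ENNReal.ofReal, ENNReal.coe_lt_coe] at hr
  rw [← Real.coe_toNNReal _ (Metric.infDist_nonneg (x := x) (s := M))]
  exact_mod_cast hr

theorem halfspace_aux {N : ℕ} (c z : EuclideanSpace ℝ (Fin N)) (σ : Set (EuclideanSpace ℝ (Fin N)))
    (b : ℝ) (h : ∀ v ∈ σ, b ≤ ‖v - z‖ ^ 2 - ‖v - c‖ ^ 2) {x : EuclideanSpace ℝ (Fin N)}
    (hx : x ∈ convexHull ℝ σ) : b ≤ ‖x - z‖ ^ 2 - ‖x - c‖ ^ 2 := by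
  have hg : ∀ v : EuclideanSpace ℝ (Fin N), ‖v - z‖ ^ 2 - ‖v - c‖ ^ 2
      = inner ℝ ((2 : ℝ) • (c - z)) v + (‖z‖ ^ 2 - ‖c‖ ^ 2) := by
    intro v
    rw [norm_sub_sq_real, norm_sub_sq_real, inner_smul_left, inner_sub_left, real_inner_comm v z,
      real_inner_comm v c, conj_trivial]
    ring
  have hconv : Convex ℝ {v : EuclideanSpace ℝ (Fin N) |
      b - (‖z‖ ^ 2 - ‖c‖ ^ 2) ≤ innerSL ℝ ((2 : ℝ) • (c - z)) v} :=
    convex_halfSpace_ge (innerSL ℝ ((2 : ℝ) • (c - z))).toLinearMap.isLinear _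
  have hsub := convexHull_min (s := σ) (fun v hv => by
    have := h v hv
    rw [hg] at this
    simp only [mem_ofPred_eq, innerSL_apply_apply]
    linarith) hconv hx
  simp only [mem_ofPred_eq, innerSL_apply_apply] at hsub
  rw [hg]; linarith

theorem dist_aux {N d : ℕ} {M : Set (EuclideanSpace ℝ (Fin N))}
    (hM : IsC2Submanifold d M) (hMc : IsCompact M) (hMne : M.Nonempty)
    {R δ ρ : ℝ} (hRpos : 0 < R)
    (huniq : ∀ x, Metric.infDist x M < R → HasUniqueNearest M x)
    (hδ : 0 ≤ δ) (hδρ : 16 * δ ≤ ρ) (hρR : ρ ≤ R / 3)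
    {σ : Set (EuclideanSpace ℝ (Fin N))}
    (hσM : ∀ v ∈ σ, Metric.infDist v M ≤ δ)
    {c : EuclideanSpace ℝ (Fin N)} (hsmall : σ ⊆ Metric.closedBall c ρ)
    {x m : EuclideanSpace ℝ (Fin N)} (hx : x ∈ convexHull ℝ σ)
    (hm : m ∈ M) (hxm : Metric.infDist x M = ‖x - m‖) {v : EuclideanSpace ℝ (Fin N)} (hv : v ∈ σ) :
    ‖(tangentSpan M m)ᗮ.starProjection (v - m)‖ ≤ 3 * ρ ^ 2 / R + δ := by
  have hρ0 : 0 ≤ ρ := by linarith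
  have hxc : ‖x - c‖ ≤ ρ := by
    have := convexHull_min hsmall (convex_closedBall c ρ) hx
    simpa [dist_eq_norm] using this
  have hvc : ∀ w ∈ σ, ‖w - c‖ ≤ ρ := by
    intro w hw
    simpa [dist_eq_norm] using hsmall hw
  have hvx : ‖x - v‖ ≤ 2 * ρ := by
    have := norm_sub_le_norm_sub_add_norm_sub x c v
    rw [norm_sub_rev c v] at this
    linarith [hvc v hv]
  have hnear : ∀ w ∈ σ, ∃ q ∈ M, Metric.infDist w M = ‖w - q‖ ∧ ‖w - q‖ ≤ δ := by
    intro w hw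
    obtain ⟨q, hq, hq'⟩ := hMc.exists_infDist_eq_dist hMne w
    rw [dist_eq_norm] at hq'
    exact ⟨q, hq, hq', hq' ▸ hσM w hw⟩
  obtain ⟨q, hqM, hq1, hq2⟩ := hnear v hv
  set h := ‖x - m‖ with hh
  have hh0 : 0 ≤ h := norm_nonneg _
  have hhR : h < R := by
    rw [← hxm]
    have h1 := Metric.infDist_le_dist_of_mem (x := x) hqM
    rw [dist_eq_norm] at h1
    have := norm_sub_le_norm_sub_add_norm_sub x v q
    linarith
  have hh3 : h ≤ 3 / 10 * R := by
    rcases hh0.eq_or_lt with h0 | hpos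
    · rw [← h0]; positivity
    set z := m + (R / h) • (x - m) with hz
    have hzx : ‖x - z‖ = R - h := by
      have : x - z = (1 - R / h) • (x - m) := by rw [hz, sub_smul, one_smul]; abel
      rw [this, norm_smul, ← hh, Real.norm_of_nonpos]
      · field_simp; ring
      · rw [sub_nonpos, le_div_iff₀ hpos]; linarith
    have hb : ∀ w ∈ σ, (R - δ) ^ 2 - ρ ^ 2 ≤ ‖w - z‖ ^ 2 - ‖w - c‖ ^ 2 := by
      intro w hw
      obtain ⟨p, hpM, hp1, hp2⟩ := hnear w hw
      have h1 := ball_aux hMc hMne huniq hm hxm hhR hpM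
      rw [← hh] at h1
      have h2 : R ≤ ‖p - z‖ := by
        have h3 : p - z = (p - m) - (R / h) • (x - m) := by rw [hz]; abel
        have h4 : ‖p - z‖ ^ 2 = ‖p - m‖ ^ 2 - 2 * (R / h * inner ℝ (p - m) (x - m)) + R ^ 2 := by
          rw [h3, norm_sub_sq_real, inner_smul_right, norm_smul, ← hh,
            Real.norm_of_nonneg (by positivity), div_mul_cancel₀ _ hpos.ne']
        have h5 : 2 * (R / h * inner ℝ (p - m) (x - m)) ≤ ‖p - m‖ ^ 2 := by
          have : 2 * (R / h * inner ℝ (p - m) (x - m))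
            = (2 * R * inner ℝ (p - m) (x - m)) / h := by ring
          rw [this, div_le_iff₀ hpos]; linarith
        have h6 : R ^ 2 ≤ ‖p - z‖ ^ 2 := by linarith
        exact le_of_sq_le_sq_aux h6 (norm_nonneg _)
      have h7 : R - δ ≤ ‖w - z‖ := by
        have := norm_sub_le_norm_sub_add_norm_sub p w z
        rw [norm_sub_rev p w] at this
        linarith
      have h8 : (R - δ) ^ 2 ≤ ‖w - z‖ ^ 2 := pow_le_pow_left₀ (by linarith) h7 2
      have h9 : ‖w - c‖ ^ 2 ≤ ρ ^ 2 := pow_le_pow_left₀ (norm_nonneg _) (hvc w hw) 2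
      linarith
    have hfin := halfspace_aux c z σ _ hb hx
    rw [hzx] at hfin
    have h1 : (47 / 48 * R) ^ 2 ≤ (R - δ) ^ 2 :=
      pow_le_pow_left₀ (by positivity) (by linarith) 2
    have h2 : ρ ^ 2 ≤ (R / 3) ^ 2 := pow_le_pow_left₀ hρ0 hρR 2
    by_contra hcon
    push Not at hcon
    have h3 : (R - h) ^ 2 ≤ (7 / 10 * R) ^ 2 := pow_le_pow_left₀ (by linarith) (by linarith) 2
    nlinarith [sq_nonneg ‖x - c‖, mul_pos hRpos hRpos]
  have hqm : ‖q - m‖ ^ 2 ≤ 6 * ρ ^ 2 := by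
    have b1 := ball_aux hMc hMne huniq hm hxm hhR hqM
    have b2 := ball_aux hMc hMne huniq hqM hq1 (by linarith) hm
    rw [← hh] at b1
    rw [norm_sub_rev m q] at b2
    have e1 : inner ℝ (q - m) (x - m) + inner ℝ (m - q) (v - q)
        = inner ℝ (q - m) (x - v) + ‖q - m‖ ^ 2 := by
      rw [← real_inner_self_eq_norm_sq, ← inner_add_right, ← neg_sub q m, inner_neg_left,
        ← sub_eq_add_neg, ← inner_sub_right]
      congr 1; abel
    have e2 : -(‖q - m‖ * (2 * ρ)) ≤ inner ℝ (q - m) (x - v) := by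
      have := abs_real_inner_le_norm (q - m) (x - v)
      have h2 := (abs_le.mp this).1
      have h3 := mul_le_mul_of_nonneg_left hvx (norm_nonneg (q - m))
      linarith
    set L := ‖q - m‖ with hL
    have hL0 : 0 ≤ L := norm_nonneg _
    have e3 : 2 * R * (L ^ 2 - L * (2 * ρ)) ≤ (h + δ) * L ^ 2 := by
      have : 2 * R * (L ^ 2 - L * (2 * ρ))
          ≤ 2 * R * (inner ℝ (q - m) (x - m) + inner ℝ (m - q) (v - q)) :=
        mul_le_mul_of_nonneg_left (by linarith) (by positivity)
      nlinarith [mul_le_mul_of_nonneg_right hq2 (sq_nonneg L)]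
    have e4 : (h + δ) * L ^ 2 ≤ (33 / 100 * R) * L ^ 2 :=
      mul_le_mul_of_nonneg_right (by linarith) (sq_nonneg L)
    have e5 : R * L * (167 * L) ≤ R * L * (400 * ρ) := by nlinarith
    have e6 : 167 * L ≤ 400 * ρ := by
      rcases hL0.eq_or_lt with h0 | hpos
      · rw [← h0]; linarith
      · exact le_of_mul_le_mul_left e5 (by positivity)
    nlinarith
  have hF := federer_aux hM hMc hMne hRpos huniq hm hqM
  have hsplit : v - m = (v - q) + (q - m) := by abel
  rw [hsplit, map_add]
  refine (norm_add_le _ _).trans ?_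
  have h1 := Submodule.norm_starProjection_apply_le (tangentSpan M m)ᗮ (v - q)
  have h2 : ‖q - m‖ ^ 2 / (2 * R) ≤ 3 * ρ ^ 2 / R := by
    rw [div_le_div_iff₀ (by positivity) hRpos]
    nlinarith
  linarith

/-- **Angle between a small simplex near `M` and nearby tangent spaces.**
Let `M ⊆ ℝ^N` be a compact `C²` `d`-submanifold with reach `R > 0`, and `σ` a
non-degenerate simplex contained in the `δ`-tubular neighborhood of `M` and in
a ball of radius `ρ`, with `16δ ≤ ρ ≤ R/3`.  Then for every `x ∈ Conv σ`,
`∠(Aff σ, T_{π_M(x)} M) ≤ arcsin( (2 dim σ / height σ) · (3ρ²/R + δ) )`. -/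
theorem angle_simplex_tangent_bound
    {N d : ℕ} (M : Set (EuclideanSpace ℝ (Fin N)))
    (hM : IsC2Submanifold d M) (hMc : IsCompact M) (hMne : M.Nonempty)
    (R δ ρ : ℝ) (hRpos : 0 < R) (hreach : ENNReal.ofReal R = reach M)
    (hδ : 0 ≤ δ) (hδρ : 16 * δ ≤ ρ) (hρR : ρ ≤ R / 3)
    (σ : Finset (EuclideanSpace ℝ (Fin N))) (hσne : σ.Nonempty)
    (hindep : AffineIndependent ℝ (fun p : (σ : Set (EuclideanSpace ℝ (Fin N))) => (p : EuclideanSpace ℝ (Fin N))))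
    (hσM : ∀ v ∈ σ, Metric.infDist v M ≤ δ)
    (c : EuclideanSpace ℝ (Fin N)) (hsmall : (σ : Set (EuclideanSpace ℝ (Fin N))) ⊆ Metric.closedBall c ρ)
    (x : EuclideanSpace ℝ (Fin N)) (hx : x ∈ convexHull ℝ (σ : Set (EuclideanSpace ℝ (Fin N)))) :
    subspaceAngle (affineSpan ℝ (σ : Set (EuclideanSpace ℝ (Fin N)))).direction
        (tangentSpan M (nearestPt M x)) ≤
      Real.arcsin ((2 * ((σ.card - 1 : ℕ) : ℝ) / simplexHeight σ hσne) * (3 * ρ ^ 2 / R + δ)) := by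

  set t := 3 * ρ ^ 2 / R + δ with ht
  have ht0 : 0 ≤ t := by positivity
  have hheight0 : 0 ≤ simplexHeight σ hσne := by
    unfold simplexHeight
    exact Finset.le_inf' _ _ (fun v _ => Metric.infDist_nonneg)
  have hs0 : 0 ≤ (2 * ((σ.card - 1 : ℕ) : ℝ) / simplexHeight σ hσne) * t := by positivity
  set m := nearestPt M x with hmdef
  have hmspec : m ∈ M ∧ dist x m = Metric.infDist x M := by
    have hex : ∃ m ∈ M, dist x m = Metric.infDist x M := by
      obtain ⟨y, hy, hy'⟩ := hMc.exists_infDist_eq_dist hMne x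
      exact ⟨y, hy, hy'.symm⟩
    rw [hmdef, nearestPt, dif_pos hex]
    exact hex.choose_spec
  have huniq := uniq_aux hreach
  have hdist : ∀ v ∈ σ, ‖(tangentSpan M m)ᗮ.starProjection (v - m)‖ ≤ t := fun v hv =>
    dist_aux hM hMc hMne hRpos huniq hδ hδρ hρR (σ := (σ : Set (EuclideanSpace ℝ (Fin N))))
      (fun w hw => hσM w hw) hsmall hx hmspec.1 (by rw [← hmspec.2, dist_eq_norm]) hv
  unfold subspaceAngle
  refine Real.sSup_le ?_ (Real.arcsin_nonneg.mpr hs0)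
  rintro _ ⟨w, hw, hw0, rfl⟩
  refine angle_aux _ hw0 hs0 ?_
  rw [direction_affineSpan] at hw
  have hcard : 2 ≤ σ.card := by
    by_contra hlt
    push Not at hlt
    have h1 : σ.card = 1 := by have := hσne.card_pos; omega
    obtain ⟨v, rfl⟩ := Finset.card_eq_one.mp h1
    rw [Finset.coe_singleton, vectorSpan_singleton, Submodule.mem_bot] at hw
    exact hw0 hw
  have hHpos : 0 < simplexHeight σ hσne := by
    unfold simplexHeight
    rw [Finset.lt_inf'_iff]
    intro v hv
    have hne : (σ.erase v).Nonempty := by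
      rw [← Finset.card_pos, Finset.card_erase_of_mem hv]; omega
    refine ((AffineSubspace.closed_of_finiteDimensional _).notMem_iff_infDist_pos ?_).mp ?_
    · exact (affineSpan_nonempty ℝ).mpr (Finset.coe_nonempty.mpr hne)
    · have := hindep.notMem_affineSpan_sdiff ⟨v, hv⟩ Set.univ
      intro hcon
      apply this
      suffices himg : ((fun p : (σ : Set (EuclideanSpace ℝ (Fin N))) =>
          (p : EuclideanSpace ℝ (Fin N))) '' (Set.univ \ {⟨v, hv⟩}))
          = ((σ.erase v : Finset (EuclideanSpace ℝ (Fin N))) : Set (EuclideanSpace ℝ (Fin N))) by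
        rw [himg]; exact hcon
      ext y
      simp only [Set.mem_image, Set.mem_sdiff, Set.mem_univ, true_and, Set.mem_singleton_iff,
        Finset.coe_erase]
      constructor
      · rintro ⟨⟨y, hy⟩, hyv, rfl⟩
        exact ⟨hy, fun h => hyv (Subtype.ext h)⟩
      · rintro ⟨hy, hyv⟩
        exact ⟨⟨y, hy⟩, fun h => hyv (congrArg Subtype.val h), rfl⟩
  obtain ⟨a, ha, haw⟩ := coeff_aux σ hw
  have hw2 : w = ∑ v ∈ σ, a v • (v - m) := by
    simp only [smul_sub, Finset.sum_sub_distrib, ← Finset.sum_smul, ha, haw, zero_smul, sub_zero]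
  set H := simplexHeight σ hσne with hH
  have hcoef : ∀ v ∈ σ, |a v| ≤ ‖w‖ / H := by
    intro v hv
    rw [le_div_iff₀ hHpos]
    refine le_trans (mul_le_mul_of_nonneg_left ?_ (abs_nonneg _)) (altitude_aux σ ha haw hv)
    rw [hH]; unfold simplexHeight
    exact Finset.inf'_le (fun v => Metric.infDist v (affineSpan ℝ ((σ.erase v : Finset (EuclideanSpace ℝ (Fin N))) : Set (EuclideanSpace ℝ (Fin N))) : Set (EuclideanSpace ℝ (Fin N)))) hv
  have hbound : ‖(tangentSpan M m)ᗮ.starProjection w‖ ≤ σ.card * (‖w‖ / H * t) := by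
    conv_lhs => rw [hw2]
    rw [map_sum]
    refine (norm_sum_le _ _).trans ?_
    rw [← nsmul_eq_mul]
    refine Finset.sum_le_card_nsmul _ _ _ ?_
    intro v hv
    rw [map_smul, norm_smul, Real.norm_eq_abs]
    exact mul_le_mul (hcoef v hv) (hdist v hv) (norm_nonneg _) (by positivity)
  refine hbound.trans ?_
  have hc2 : (σ.card : ℝ) ≤ 2 * ((σ.card - 1 : ℕ) : ℝ) := by
    have : σ.card ≤ 2 * (σ.card - 1) := by omega
    exact_mod_cast this
  calc (σ.card : ℝ) * (‖w‖ / H * t) ≤ 2 * ((σ.card - 1 : ℕ) : ℝ) * (‖w‖ / H * t) :=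
        mul_le_mul_of_nonneg_right hc2 (by positivity)
    _ = _ := by ring
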